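/- If every 2-maximal subgroup of a finite group G is modular in G, then G is nearly nilpotent. -/

import Mathlib

open Subgroup Pointwise

variable {G : Type*} [Group G]

/-- A subgroup `M` of `G` is modular if it is a modular element of the lattice of
subgroups of `G`. -/
def IsModularSubgroup (M : Subgroup G) : Prop :=
  (∀ X Z : Subgroup G, X ≤ Z → X ⊔ (M ⊓ Z) = (X ⊔ M) ⊓ Z) ∧
  (∀ Y Z : Subgroup G, M ≤ Z → M ⊔ (Y ⊓ Z) = (M ⊔ Y) ⊓ Z)

/-- A subgroup `H` of `G` is S-quasinormal if `HP = PH` for every Sylow subgroup `P` of `G`. -/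
def IsSQuasinormal (H : Subgroup G) : Prop :=
  ∀ (p : ℕ), p.Prime → ∀ P : Sylow p G,
    (H : Set G) * ((P : Subgroup G) : Set G) = ((P : Subgroup G) : Set G) * (H : Set G)

/-- `H` is a maximal subgroup of `K` (both being subgroups of the ambient group `G`). -/
def IsMaximalIn (K H : Subgroup G) : Prop :=
  H < K ∧ ∀ L : Subgroup G, H < L → L ≤ K → L = K

/-- `H` is an `n`-maximal subgroup of `G`: there is a chain
`H = M_n < … < M_1 < M_0 = G` with `M_i` maximal in `M_{i-1}` for all `i`. -/
def IsNMaximal (n : ℕ) (H : Subgroup G) : Prop :=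
  ∃ M : Fin (n + 1) → Subgroup G,
    M 0 = ⊤ ∧ M (Fin.last n) = H ∧
    ∀ i : Fin n, IsMaximalIn (M i.castSucc) (M i.succ)

/-- A group is supersoluble if it has a normal series with cyclic factors. -/
def IsSupersoluble (G : Type*) [Group G] : Prop :=
  ∃ (n : ℕ) (s : Fin (n + 1) → Subgroup G) (_hnorm : ∀ i, (s i).Normal),
    s 0 = ⊥ ∧ s (Fin.last n) = ⊤ ∧
    ∀ i : Fin n, s i.castSucc ≤ s i.succ ∧
      haveI := _hnorm i.castSucc
      IsCyclic ↥((s i.succ).map (QuotientGroup.mk' (s i.castSucc)))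

/-- `H/K` is a chief factor of `G`: both are normal in `G`, `K < H`, and there is no
normal subgroup of `G` strictly between `K` and `H` (i.e. `H/K` is a minimal normal
subgroup of `G/K`). -/
def IsChiefFactor (H K : Subgroup G) : Prop :=
  K.Normal ∧ H.Normal ∧ K < H ∧
    ∀ N : Subgroup G, N.Normal → K < N → N ≤ H → N = H

/-- The centralizer `C_G(H/K)` of a factor `H/K`: the preimage in `G` of the
centralizer of `HK/K` in `G/K`. -/
def chiefCentralizer (H K : Subgroup G) (hK : K.Normal) : Subgroup G :=
  haveI := hK
  Subgroup.comap (QuotientGroup.mk' K)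
    (Subgroup.centralizer ((H.map (QuotientGroup.mk' K) : Subgroup (G ⧸ K)) : Set (G ⧸ K)))

/-- The factor `H/K` is non-Frattini, i.e. `HK/K ≰ Φ(G/K)`. -/
def IsNonFrattini (H K : Subgroup G) (hK : K.Normal) : Prop :=
  haveI := hK
  ¬ H.map (QuotientGroup.mk' K) ≤ frattini (G ⧸ K)

/-- A group is strongly supersoluble if it is supersoluble and the automorphism group
`G/C_G(H/K)` induced by `G` on any chief factor `H/K` has square-free order. -/
def IsStronglySupersoluble (G : Type*) [Group G] : Prop :=
  IsSupersoluble G ∧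
    ∀ H K : Subgroup G, ∀ hc : IsChiefFactor H K,
      Squarefree (chiefCentralizer H K hc.1).index

/-- A group is nearly nilpotent if it is supersoluble and the automorphism group
`G/C_G(H/K)` induced by `G` on any non-Frattini chief factor `H/K` has order dividing
a prime. -/
def IsNearlyNilpotent (G : Type*) [Group G] : Prop :=
  IsSupersoluble G ∧
    ∀ H K : Subgroup G, ∀ hc : IsChiefFactor H K, IsNonFrattini H K hc.1 →
      ∃ p : ℕ, p.Prime ∧ (chiefCentralizer H K hc.1).index ∣ p

/-- The strongly supersoluble residual `G^{U_s}`: the intersection of all normal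
subgroups `N` of `G` with `G/N` strongly supersoluble. -/
def ssResidual (G : Type*) [Group G] : Subgroup G :=
  sInf {N : Subgroup G | ∃ _hN : N.Normal,
    haveI := _hN
    IsStronglySupersoluble (G ⧸ N)}

open scoped commutatorElement

/-- `M` is a maximal subgroup which is modular: every subgroup `Z` not contained in `M` meets `M`
in a maximal subgroup of `Z`. -/
def IsModularMaximal (M : Subgroup G) : Prop :=
  M ≠ ⊤ ∧ ∀ X Z : Subgroup G, X ≤ Z → ¬ X ≤ M → Z ≤ X ⊔ (M ⊓ Z)

/-- `Q` is abelian, or `Q` has order `t * s` for primes `t` and `s`, its derived subgroup has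
order `t`, and `t - 1` kills the quotient by the derived subgroup. -/
def HasPrimeDerived (Q : Type*) [Group Q] : Prop :=
  commutator Q = ⊥ ∨ ∃ t s : ℕ, t.Prime ∧ s.Prime ∧ Nat.card (commutator Q) = t ∧
    Nat.card Q = t * s ∧ ∀ x : Q, x ^ (t - 1) ∈ commutator Q

section Lattice

theorem IsModularMaximal.of_comap {Q : Type*} [Group Q] {f : G →* Q}
    (hf : Function.Surjective f) {M : Subgroup Q} (hM : IsModularMaximal (M.comap f)) :
    IsModularMaximal M := by
  refine ⟨fun h => hM.1 (by rw [h, comap_top]), fun X Z hXZ hX => ?_⟩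
  have h := hM.2 (X.comap f) (Z.comap f) (comap_mono hXZ)
    (fun h => hX ((comap_le_comap_of_surjective hf).1 h))
  have h' := map_mono (f := f) h
  rwa [← comap_inf, Subgroup.map_sup, map_comap_eq_self_of_surjective hf,
    map_comap_eq_self_of_surjective hf, map_comap_eq_self_of_surjective hf] at h'

theorem IsModularMaximal.comap_equiv {M : Subgroup G} (hM : IsModularMaximal M) (e : G ≃* G) :
    IsModularMaximal (M.comap e.toMonoidHom) := by
  refine IsModularMaximal.of_comap (f := e.symm.toMonoidHom) e.symm.surjective ?_
  rw [comap_comap]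
  convert hM using 1
  ext x
  simp

theorem IsModularMaximal.comap_subtype {M : Subgroup G} (hM : IsModularMaximal M)
    {H : Subgroup G} (hH : ¬ H ≤ M) : IsModularMaximal (M.comap H.subtype) := by
  refine ⟨fun h => hH fun x hx => ?_, fun X Z hXZ hX => ?_⟩
  · have : (⟨x, hx⟩ : H) ∈ M.comap H.subtype := h ▸ mem_top _
    exact this
  · have h := hM.2 (X.map H.subtype) (Z.map H.subtype) (map_mono hXZ)
      (fun h => hX (map_le_iff_le_comap.1 h))
    have h2 : M ⊓ Z.map H.subtype = (M.comap H.subtype ⊓ Z).map H.subtype := by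
      ext x
      simp only [mem_inf, mem_map, mem_comap]
      constructor
      · rintro ⟨h1, y, hy, rfl⟩
        exact ⟨y, ⟨h1, hy⟩, rfl⟩
      · rintro ⟨y, ⟨h1, hy⟩, rfl⟩
        exact ⟨h1, y, hy, rfl⟩
    rw [h2, ← Subgroup.map_sup] at h
    exact (map_le_map_iff_of_injective H.subtype_injective).1 h

theorem IsModularMaximal.sup_eq_top {M X : Subgroup G} (hM : IsModularMaximal M)
    (hX : ¬ X ≤ M) : X ⊔ M = ⊤ := by
  simpa using hM.2 X ⊤ le_top hX

theorem exists_isMaximalIn_ge [Finite G] {A L : Subgroup G} (h : A < L) :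
    ∃ T, A ≤ T ∧ IsMaximalIn L T := by
  obtain ⟨T, ⟨hAT, hTL⟩, hT⟩ := (Set.toFinite {T : Subgroup G | A ≤ T ∧ T < L}).exists_maximal
    ⟨A, le_rfl, h⟩
  refine ⟨T, hAT, hTL, fun K hTK hKL => ?_⟩
  by_contra hne
  exact absurd (hT ⟨hAT.trans hTK.le, lt_of_le_of_ne hKL hne⟩ hTK.le) (not_le_of_gt hTK)

theorem isNMaximal_two {L T : Subgroup G} (hL : IsCoatom L) (hT : IsMaximalIn L T) :
    IsNMaximal 2 T := by
  refine ⟨![⊤, L, T], rfl, rfl, fun i => ?_⟩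
  fin_cases i
  · exact ⟨lt_top_iff_ne_top.2 hL.1, fun K hK _ => hL.2 K hK⟩
  · exact hT

/-- If all 2-maximal subgroups are modular, then two maximal subgroups intersect in a maximal
subgroup of either of them. -/
theorem isMaximalIn_inf [Finite G]
    (h : ∀ M : Subgroup G, IsNMaximal 2 M → IsModularSubgroup M) {M L : Subgroup G}
    (hM : IsCoatom M) (hL : IsCoatom L) (hne : M ≠ L) : IsMaximalIn L (M ⊓ L) := by
  have hlt : M ⊓ L < L := by
    refine lt_of_le_of_ne inf_le_right fun h => hne ?_
    rcases hL.le_iff.1 (inf_eq_right.1 h) with h | h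
    · exact absurd h hM.1
    · exact h
  obtain ⟨T, hT, hTL⟩ := exists_isMaximalIn_ge hlt
  have hTM : T ≤ M := by
    by_contra hTM
    have h1 := (h T (isNMaximal_two hL hTL)).2 M L hTL.1.le
    rw [sup_comm T M, hM.2 _ (left_lt_sup.2 hTM), sup_eq_left.2 hT, top_inf_eq] at h1
    exact hTL.1.ne h1
  rwa [le_antisymm hT (le_inf hTM hTL.1.le)]

theorem isModularMaximal_of_isCoatom [Finite G]
    (h : ∀ M : Subgroup G, IsNMaximal 2 M → IsModularSubgroup M) {M : Subgroup G}
    (hM : IsCoatom M) : IsModularMaximal M := by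
  refine ⟨hM.1, fun X Z hXZ hX => ?_⟩
  rcases eq_top_or_exists_le_coatom Z with rfl | ⟨L, hL, hZL⟩
  · rw [sup_comm, inf_top_eq, hM.2 _ (left_lt_sup.2 hX)]
  · have hne : M ≠ L := by
      rintro rfl
      exact hX (hXZ.trans hZL)
    have hT := isMaximalIn_inf h hM hL hne
    have h1 := (h _ (isNMaximal_two hL hT)).1 X Z hXZ
    have h2 : X ⊔ M ⊓ L = L := by
      refine hT.2 _ (right_lt_sup.2 fun h => hX (h.trans inf_le_left))
        (sup_le (hXZ.trans hZL) inf_le_right)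
    rw [h2, inf_assoc, inf_eq_right.2 hZL] at h1
    rw [h1]

end Lattice

section CoreFree

/-- The powers by `t - 1` centralize a normal subgroup of prime order `t`. -/
theorem pow_sub_one_commute_of_prime_card [Finite G] {N : Subgroup G} [N.Normal] {t : ℕ}
    (ht : t.Prime) (hN : Nat.card N = t) (x : G) {n : G} (hn : n ∈ N) :
    x ^ (t - 1) * n = n * x ^ (t - 1) := by
  have : Fact t.Prime := ⟨ht⟩
  have : IsCyclic N := isCyclic_of_prime_card hN
  have hc : Nat.card (MulAut N) = t - 1 := by
    rw [IsCyclic.card_mulAut, hN, Nat.totient_prime ht]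
  have h1 : (MulAut.conjNormal (H := N) x) ^ (t - 1) = 1 := by
    rw [← hc]
    exact pow_card_eq_one'
  rw [← map_pow] at h1
  have h2 := MulAut.conjNormal_apply (H := N) (x ^ (t - 1)) ⟨n, hn⟩
  rw [h1] at h2
  exact (mul_inv_eq_iff_eq_mul.1 h2.symm)

theorem hasPrimeDerived_of_commutative_normal [Finite G] {M N : Subgroup G}
    (hM : IsModularMaximal M) (hcore : M.normalCore = ⊥) [N.Normal] (hN : N ≠ ⊥)
    (hcomm : ∀ a ∈ N, ∀ b ∈ N, a * b = b * a) : HasPrimeDerived G := by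
  have hNM : ¬ N ≤ M := fun h => hN (le_bot_iff.1 (hcore ▸ normal_le_normalCore.2 h))
  have hprod : ∀ g : G, ∃ n ∈ N, ∃ m ∈ M, n * m = g := fun g =>
    mem_sup_of_normal_left.1 (hM.sup_eq_top hNM ▸ mem_top g)
  have key : ∀ a ∈ M, (∀ k ∈ M, ∀ n ∈ N, n * (k * a * k⁻¹) = (k * a * k⁻¹) * n) → a = 1 := by
    intro a ha h
    rw [← mem_bot, ← hcore]
    intro b
    obtain ⟨n, hn, k, hk, rfl⟩ := hprod b
    have : n * k * a * (n * k)⁻¹ = k * a * k⁻¹ := by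
      calc n * k * a * (n * k)⁻¹ = n * (k * a * k⁻¹) * n⁻¹ := by group
        _ = k * a * k⁻¹ := by rw [h k hk n hn, mul_inv_cancel_right]
    rw [this]
    exact M.mul_mem (M.mul_mem hk ha) (M.inv_mem hk)
  have hinf : ∀ a ∈ N, a ∈ M → a = 1 := fun a haN haM => key a haM fun k _ n hn =>
    hcomm n hn _ (Normal.conj_mem ‹_› a haN k)
  have hcent : ∀ a ∈ M, (∀ n ∈ N, a * n = n * a) → a = 1 := by
    refine fun a haM h => key a haM fun k _ n hn => ?_
    have h1 := h (k⁻¹ * n * k) (by simpa using Normal.conj_mem ‹N.Normal› n hn k⁻¹)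
    calc n * (k * a * k⁻¹) = k * ((k⁻¹ * n * k) * a) * k⁻¹ := by group
      _ = k * (a * (k⁻¹ * n * k)) * k⁻¹ := by rw [h1]
      _ = k * a * k⁻¹ * n := by group
  have hMN : M ⊓ N = ⊥ := (eq_bot_iff_forall _).2 fun a ha => hinf a ha.2 ha.1
  have hgen : ∀ y ∈ N, y ≠ 1 → N = zpowers y := by
    intro y hy hy1
    refine le_antisymm ?_ (zpowers_le.2 hy)
    have := hM.2 (zpowers y) N (zpowers_le.2 hy)
      (fun h => hy1 (hinf y hy (h (mem_zpowers y))))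
    rwa [hMN, sup_bot_eq] at this
  obtain ⟨t, ht, hNt⟩ : ∃ t : ℕ, t.Prime ∧ Nat.card N = t := by
    have h1 : Nat.card N ≠ 1 := fun h => hN (card_eq_one.1 h)
    have : Fact (Nat.card N).minFac.Prime := ⟨Nat.minFac_prime h1⟩
    obtain ⟨y, hy⟩ := exists_prime_orderOf_dvd_card' (G := N) _ (Nat.minFac_dvd (Nat.card N))
    refine ⟨_, Nat.minFac_prime h1, ?_⟩
    have hy1 : (y : G) ≠ 1 := by
      intro h
      rw [← orderOf_eq_one_iff, orderOf_coe, hy] at h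
      exact (Nat.minFac_prime h1).ne_one h
    have h2 : Nat.card N = orderOf (y : G) := by
      rw [← Nat.card_zpowers, ← hgen y y.2 hy1]
    rw [orderOf_coe, hy] at h2
    exact h2
  by_cases hM1 : M = ⊥
  · left
    rw [_root_.commutator, eq_bot_iff, commutator_le]
    have hall : ∀ g : G, g ∈ N := by
      intro g
      obtain ⟨n, hn, m, hm, rfl⟩ := hprod g
      rw [hM1, mem_bot] at hm
      simpa [hm] using hn
    intro a _ b _
    rw [mem_bot, commutatorElement_eq_one_iff_mul_comm]
    exact hcomm a (hall a) b (hall b)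
  have hcardM : (Nat.card M).Prime := by
    have h1 : Nat.card M ≠ 1 := fun h => hM1 (card_eq_one.1 h)
    have : Fact (Nat.card M).minFac.Prime := ⟨Nat.minFac_prime h1⟩
    obtain ⟨m, hm⟩ := exists_prime_orderOf_dvd_card' (G := M) _ (Nat.minFac_dvd (Nat.card M))
    have hm1 : (m : G) ≠ 1 := by
      intro h
      rw [← orderOf_eq_one_iff, orderOf_coe, hm] at h
      exact (Nat.minFac_prime h1).ne_one h
    obtain ⟨n, hn, hmn⟩ : ∃ n ∈ N, (m : G) * n ≠ n * m := by
      by_contra! h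
      exact hm1 (hcent m m.2 h)
    have hn1 : n ≠ 1 := by
      rintro rfl
      simp at hmn
    have hcom : ∀ a ∈ M, n * a * n⁻¹ ∈ M → a * n = n * a := by
      intro a ha h
      have h2 : n * (a * n⁻¹ * a⁻¹) = 1 := by
        refine hinf _ (N.mul_mem hn (Normal.conj_mem ‹_› _ (N.inv_mem hn) a)) ?_
        have := M.mul_mem h (M.inv_mem ha)
        convert this using 1
        group
      calc a * n = (n * (a * n⁻¹ * a⁻¹)) * (a * n) := by rw [h2, one_mul]
        _ = n * a := by group
    have hM2 := (hM.comap_equiv (MulAut.conj n)).2 (zpowers (m : G)) M (zpowers_le.2 m.2)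
      (fun h => hmn (hcom m m.2 (by simpa using h (mem_zpowers _))))
    have hbot : M.comap (MulAut.conj n).toMonoidHom ⊓ M = ⊥ := by
      refine (eq_bot_iff_forall _).2 fun a ha => hcent a ha.2 fun k hk => ?_
      rw [hgen n hn hn1] at hk
      have h3 : Commute a n := hcom a ha.2 (by simpa using ha.1)
      obtain ⟨i, rfl⟩ := hk
      exact (h3.zpow_right i).eq
    rw [hbot, sup_bot_eq] at hM2
    have h4 : Nat.card M = orderOf (m : G) := by
      rw [← Nat.card_zpowers, ← le_antisymm hM2 (zpowers_le.2 m.2)]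
    rw [h4, orderOf_coe, hm]
    exact Nat.minFac_prime h1
  have hindex : N.index = Nat.card M := by
    rw [← relIndex_top_right, ← hM.sup_eq_top hNM, relIndex_sup_left, ← inf_relIndex_left,
      hMN, relIndex_bot_left]
  have hcardG : Nat.card G = t * Nat.card M := by
    rw [← N.card_mul_index, hindex, hNt]
  have hle : commutator G ≤ N := by
    have : Fact (Nat.card M).Prime := ⟨hcardM⟩
    have : IsCyclic (G ⧸ N) := isCyclic_of_prime_card (p := Nat.card M) hindex
    rw [_root_.commutator, commutator_le]
    intro a _ b _
    rw [← QuotientGroup.eq_one_iff]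
    rw [← QuotientGroup.mk'_apply, map_commutatorElement, commutatorElement_eq_one_iff_mul_comm]
    exact IsCyclic.isMulCommutative.is_comm.comm _ _
  rcases (Nat.dvd_prime ht).1 (hNt ▸ card_dvd_of_le hle) with h | h
  · exact Or.inl (card_eq_one.1 h)
  · have hEq : commutator G = N := eq_of_le_of_card_ge hle (by rw [h, hNt])
    refine Or.inr ⟨t, _, ht, hcardM, h, hcardG, fun x => ?_⟩
    rw [hEq]
    have hx := fun n (hn : n ∈ N) => pow_sub_one_commute_of_prime_card ht hNt x hn
    obtain ⟨n, hn, m, hm, h1⟩ := hprod (x ^ (t - 1))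
    have : m = 1 := by
      refine hcent m hm fun k hk => ?_
      have h2 := hx k hk
      rw [← h1, mul_assoc, ← mul_assoc k, hcomm k hk n hn, mul_assoc] at h2
      exact mul_left_cancel h2
    rw [← h1, this, mul_one]
    exact hn

end CoreFree

section PrimeDerived

theorem HasPrimeDerived.commute {Q : Type*} [Group Q] (hQ : HasPrimeDerived Q) {a b : Q}
    (ha : a ∈ commutator Q) (hb : b ∈ commutator Q) : a * b = b * a := by
  rcases hQ with h | ⟨t, s, ht, -, h, -, -⟩
  · rw [h, mem_bot] at ha hb
    rw [ha, hb]
  · have : Fact t.Prime := ⟨ht⟩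
    have : IsCyclic (commutator Q) := isCyclic_of_prime_card h
    exact congrArg Subtype.val
      (IsCyclic.isMulCommutative.is_comm.comm (⟨a, ha⟩ : commutator Q) ⟨b, hb⟩)

theorem eq_one_of_pow_eq_one_of_coprime {u : G} {m n : ℕ} (hm : u ^ m = 1) (hn : u ^ n = 1)
    (h : m.Coprime n) : u = 1 := by
  rw [← orderOf_eq_one_iff]
  exact Nat.eq_one_of_dvd_coprimes h (orderOf_dvd_of_pow_eq_one hm) (orderOf_dvd_of_pow_eq_one hn)

theorem HasPrimeDerived.eq_one {Q : Type*} [Group Q] [Finite Q] (hQ : HasPrimeDerived Q) {p k : ℕ}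
    (hp : p.Prime) (hcop : (p - 1).Coprime (Nat.card Q)) {u : Q} (hu : u ∈ commutator Q)
    (huk : u ^ p ^ k = 1) : u = 1 := by
  rcases hQ with h | ⟨t, s, ht, hs, h, hQ, hpow⟩
  · rwa [h, mem_bot] at hu
  · by_cases htp : t = p
    · subst htp
      exfalso
      have htop : commutator Q = ⊤ := by
        rw [eq_top_iff]
        intro x _
        have h1 : (commutator Q).index = 1 := by
          refine Nat.eq_one_of_dvd_coprimes hcop ?_ (commutator Q).index_dvd_card
          have h2 : (commutator Q).index = s := by
            have := (commutator Q).card_mul_index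
            rw [h, hQ] at this
            exact Nat.eq_of_mul_eq_mul_left ht.pos this
          have : Fact s.Prime := ⟨hs⟩
          rw [h2]
          obtain ⟨y, hy⟩ := exists_prime_orderOf_dvd_card' (G := Q ⧸ commutator Q) s
            (by rw [← index_eq_card, h2])
          obtain ⟨x, rfl⟩ := QuotientGroup.mk_surjective y
          rw [← hy]
          refine orderOf_dvd_of_pow_eq_one ?_
          rw [← QuotientGroup.mk_pow, QuotientGroup.eq_one_iff]
          exact hpow x
        rw [index_eq_one.1 h1]
        trivial
      rw [htop, card_top, hQ] at h
      have := hs.one_lt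
      nlinarith [ht.pos]
    · have hut : u ^ t = 1 := by
        have := pow_card_eq_one' (x := (⟨u, hu⟩ : commutator Q))
        rw [h] at this
        exact congrArg Subtype.val this
      exact eq_one_of_pow_eq_one_of_coprime hut huk
        (((Nat.coprime_primes ht hp).2 htp).pow_right k)

end PrimeDerived

section ModularMaximal

universe u

theorem IsModularMaximal.map_mk {M : Subgroup G} (hM : IsModularMaximal M) :
    IsModularMaximal (M.map (QuotientGroup.mk' M.normalCore)) := by
  refine IsModularMaximal.of_comap (QuotientGroup.mk'_surjective _) ?_
  rwa [comap_map_eq_self (by simpa using M.normalCore_le)]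

theorem normalCore_map_mk (M : Subgroup G) :
    (M.map (QuotientGroup.mk' M.normalCore)).normalCore = ⊥ := by
  refine (eq_bot_iff_forall _).2 fun x hx => ?_
  obtain ⟨x, rfl⟩ := QuotientGroup.mk_surjective x
  rw [QuotientGroup.eq_one_iff]
  intro b
  have h : b * x * b⁻¹ ∈ (M.map (QuotientGroup.mk' M.normalCore)).comap
      (QuotientGroup.mk' M.normalCore) := by
    rw [mem_comap, map_mul, map_mul, map_inv]
    exact hx (b : G ⧸ M.normalCore)
  rwa [comap_map_eq_self (by simpa using M.normalCore_le)] at h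

theorem exists_hom_hasPrimeDerived {G : Type u} [Group G] [Finite G] {M : Subgroup G}
    (hM : IsModularMaximal M) {H : Subgroup G}
    (ih : ∀ (Q : Type u) [Group Q] [Finite Q], Nat.card Q ≤ Nat.card H → ∀ L : Subgroup Q,
      IsModularMaximal L → L.normalCore = ⊥ → HasPrimeDerived Q) :
    ∃ (Q : Type u) (_ : Group Q) (_ : Finite Q) (f : H →* Q), Function.Surjective f ∧
      HasPrimeDerived Q ∧ ∀ h, f h = 1 → (h : G) ∈ M := by
  by_cases hH : H ≤ M
  · exact ⟨PUnit, inferInstance, inferInstance, 1, fun x => ⟨1, rfl⟩,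
      Or.inl (Subsingleton.elim _ _), fun h _ => hH h.2⟩
  · have hM' := hM.comap_subtype hH
    refine ⟨H ⧸ (M.comap H.subtype).normalCore, inferInstance, inferInstance,
      QuotientGroup.mk' _, QuotientGroup.mk'_surjective _,
      ih _ ?_ _ hM'.map_mk (normalCore_map_mk _), fun h hh => ?_⟩
    · exact Nat.card_le_card_of_surjective _ (QuotientGroup.mk'_surjective _)
    · exact normalCore_le (M.comap H.subtype) ((QuotientGroup.eq_one_iff h).1 hh)

theorem coprime_minFac_sub_one (n m : ℕ) (hn : n ≠ 1) (h : m ∣ n) :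
    (n.minFac - 1).Coprime m := by
  refine Nat.Coprime.coprime_dvd_right h (Nat.coprime_of_dvd fun r hr h1 h2 => ?_)
  have h3 := Nat.minFac_le_of_dvd hr.two_le h2
  have h4 := (Nat.minFac_prime hn).two_le
  have h5 := Nat.le_of_dvd (by omega) h1
  omega

theorem eq_one_of_forall_conj_mem {M : Subgroup G} (hcore : M.normalCore = ⊥) {c : G}
    (h : ∀ b : G, b * c * b⁻¹ ∈ M) : c = 1 := by
  rw [← mem_bot, ← hcore]
  exact h

theorem hasPrimeDerived_of_normalCore_eq_bot {G : Type u} [Group G] [Finite G] {M : Subgroup G}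
    (hM : IsModularMaximal M) (hcore : M.normalCore = ⊥) : HasPrimeDerived G := by
  induction hn : Nat.card G using Nat.strong_induction_on generalizing G with
  | _ n ih =>
  subst hn
  have hfam : ∀ {H : Subgroup G}, H ≠ ⊤ → ∀ b : G,
      ∃ (Q : Type u) (_ : Group Q) (_ : Finite Q) (f : H →* Q), Function.Surjective f ∧
      HasPrimeDerived Q ∧ ∀ h, f h = 1 → b * (h : G) * b⁻¹ ∈ M := by
    intro H hH b
    have hlt : Nat.card H < Nat.card G := by
      refine lt_of_le_of_ne H.card_le_card_group fun h => hH (eq_top_of_card_eq _ h)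
    simpa using exists_hom_hasPrimeDerived (hM.comap_equiv (MulAut.conj b)) (H := H)
      fun Q _ _ hQ L hL hLc => ih _ (hQ.trans_lt hlt) hL hLc rfl
  by_contra hcon
  have hab : ∀ N : Subgroup G, N.Normal → (∀ a ∈ N, ∀ b ∈ N, a * b = b * a) → N = ⊥ := by
    intro N hN h
    by_contra hne
    exact hcon (hasPrimeDerived_of_commutative_normal hM hcore hne h)
  have hG1 : Nat.card G ≠ 1 := by
    intro h
    have := (Nat.card_eq_one_iff_unique.1 h).1
    exact hM.1 (Subsingleton.elim _ _)
  have hp := Nat.minFac_prime hG1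
  set p := (Nat.card G).minFac with hpdef
  have : Fact p.Prime := ⟨hp⟩
  obtain ⟨P⟩ : Nonempty (Sylow p G) := inferInstance
  have hP1 : (P : Subgroup G) ≠ ⊥ := P.ne_bot_of_dvd_card (Nat.minFac_dvd _)
  have hnorm : normalizer ((P : Subgroup G) : Set G) ≠ ⊤ := by
    intro h
    have hPn : (P : Subgroup G).Normal := normalizer_eq_top_iff.1 h
    have : Nontrivial P := (nontrivial_iff_ne_bot _).2 hP1
    have := P.isPGroup'.center_nontrivial
    have hz := hab ((center P).map (P : Subgroup G).subtype) inferInstance (by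
      rintro _ ⟨a, ha, rfl⟩ _ ⟨b, -, rfl⟩
      exact congrArg Subtype.val ((mem_center_iff.1 ha b).symm))
    rw [map_eq_bot_iff_of_injective _ (subtype_injective _)] at hz
    exact (nontrivial_iff_ne_bot _).1 this hz
  have hburn : normalizer ((P : Subgroup G) : Set G) ≤ centralizer ((P : Subgroup G) : Set G) := by
    intro h hh
    rw [mem_centralizer_iff]
    intro u hu
    rw [← commutatorElement_eq_one_iff_mul_comm]
    have huN : u ∈ normalizer ((P : Subgroup G) : Set G) := le_normalizer hu
    have hcP : ⁅u, h⁆ ∈ (P : Subgroup G) := by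
      rw [commutatorElement_def, mul_assoc, mul_assoc, ← mul_assoc h]
      exact mul_mem hu ((mem_normalizer_iff.1 hh _).1 (inv_mem hu))
    refine eq_one_of_forall_conj_mem hcore fun b => ?_
    obtain ⟨Q, _, _, f, hf, hQ, hker⟩ := hfam hnorm b
    refine hker ⁅(⟨u, huN⟩ : normalizer ((P : Subgroup G) : Set G)), ⟨h, hh⟩⁆ ?_
    obtain ⟨k, hk⟩ := P.isPGroup' ⟨_, hcP⟩
    have hcop := coprime_minFac_sub_one (Nat.card G) (Nat.card Q) hG1
      ((card_dvd_of_surjective f hf).trans (card_subgroup_dvd_card _))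
    refine hQ.eq_one (k := k) hp hcop ?_ ?_
    · rw [map_commutatorElement]
      exact commutator_mem_commutator (mem_top _) (mem_top _)
    · rw [← map_pow, ← map_one f]
      have hk' : ⁅u, h⁆ ^ p ^ k = 1 := congrArg Subtype.val hk
      exact congrArg f (Subtype.ext hk')
  set K := (MonoidHom.transferSylow P hburn).ker
  have hK := MonoidHom.ker_transferSylow_isComplement' P hburn
  have hKtop : K ≠ ⊤ := fun h => hP1 (isComplement'_top_left.1 (h ▸ hK))
  have hKbot : K ≠ ⊥ := by
    intro h
    have hPtop : (P : Subgroup G) = ⊤ := isComplement'_bot_left.1 (h ▸ hK)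
    exact hnorm (normalizer_eq_top_iff.2 (by rw [hPtop]; infer_instance))
  have hK'' : ∀ a ∈ commutator K, ∀ b ∈ commutator K, a * b = b * a := by
    intro a ha b hb
    rw [← commutatorElement_eq_one_iff_mul_comm, ← OneMemClass.coe_eq_one]
    refine eq_one_of_forall_conj_mem hcore fun c => ?_
    obtain ⟨Q, _, _, f, hf, hQ, hker⟩ := hfam hKtop c
    refine hker _ ?_
    rw [map_commutatorElement, commutatorElement_eq_one_iff_mul_comm]
    have hmap : ∀ x ∈ commutator K, f x ∈ commutator Q := fun x hx => by
      have := mem_map_of_mem f hx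
      rw [map_commutator_eq] at this
      exact commutator_mono le_top le_top this
    exact hQ.commute (hmap a ha) (hmap b hb)
  have h1 := hab ((commutator K).map K.subtype) inferInstance (by
    rintro _ ⟨a, ha, rfl⟩ _ ⟨b, hb, rfl⟩
    exact congrArg Subtype.val (hK'' a ha b hb))
  rw [map_eq_bot_iff_of_injective _ K.subtype_injective] at h1
  refine hKbot (hab K inferInstance fun a ha b hb => ?_)
  have h2 : ⁅(⟨a, ha⟩ : K), ⟨b, hb⟩⁆ ∈ commutator K :=
    commutator_mem_commutator (mem_top _) (mem_top _)
  rw [h1, mem_bot, commutatorElement_eq_one_iff_mul_comm] at h2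
  exact congrArg Subtype.val h2

theorem IsModularMaximal.hasPrimeDerived [Finite G] {M : Subgroup G} (hM : IsModularMaximal M) :
    HasPrimeDerived (G ⧸ M.normalCore) :=
  hasPrimeDerived_of_normalCore_eq_bot hM.map_mk (normalCore_map_mk M)

end ModularMaximal

section ChiefFactor

theorem mem_chiefCentralizer {H K : Subgroup G} {hK : K.Normal} {g : G} :
    g ∈ chiefCentralizer H K hK ↔ ∀ h ∈ H, ⁅h, g⁆ ∈ K := by
  rw [chiefCentralizer, mem_comap, mem_centralizer_iff]
  constructor
  · intro hg h hh
    have h1 := hg _ (mem_map_of_mem (QuotientGroup.mk' K) hh)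
    rw [← commutatorElement_eq_one_iff_mul_comm, ← map_commutatorElement] at h1
    exact (QuotientGroup.eq_one_iff _).1 h1
  · rintro hg _ ⟨h, hh, rfl⟩
    rw [← commutatorElement_eq_one_iff_mul_comm, ← map_commutatorElement]
    exact (QuotientGroup.eq_one_iff _).2 (hg h hh)

theorem IsNonFrattini.exists_isCoatom {H K : Subgroup G} {hK : K.Normal}
    (h : IsNonFrattini H K hK) : ∃ M : Subgroup G, IsCoatom M ∧ K ≤ M ∧ ¬ H ≤ M := by
  by_contra! hcon
  refine h ?_
  rw [frattini, Order.radical]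
  refine le_iInf₂ fun M hM => ?_
  rw [map_le_iff_le_comap]
  refine hcon _ (isCoatom_comap_of_surjective (QuotientGroup.mk'_surjective K) hM) ?_
  conv_lhs => rw [← QuotientGroup.ker_mk' K]
  exact MonoidHom.ker_le_comap _ _

theorem IsChiefFactor.exists_prime_index_dvd [Finite G] {H K M : Subgroup G}
    (hc : IsChiefFactor H K) (hKM : K ≤ M) (hHM : ¬ H ≤ M)
    (hQ : HasPrimeDerived (G ⧸ M.normalCore)) :
    ∃ p : ℕ, p.Prime ∧ (chiefCentralizer H K hc.1).index ∣ p := by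
  have hKn := hc.1
  have hHn := hc.2.1
  have hKN : K ≤ M.normalCore := normal_le_normalCore.2 hKM
  have hinf : M.normalCore ⊓ H ≤ K := by
    by_contra h
    refine hHM (inf_eq_right.1 (hc.2.2.2 (M.normalCore ⊓ H) inferInstance ?_ inf_le_right)
      |>.trans M.normalCore_le)
    exact lt_of_le_of_ne (le_inf hKN hc.2.2.1.le) fun h' => h h'.ge
  have hmem : ∀ g, ∀ h ∈ H, ⁅h, g⁆ ∈ M.normalCore → ⁅h, g⁆ ∈ K := fun g h hh h1 =>
    hinf ⟨h1, commutator_le_left H ⊤ (commutator_mem_commutator hh (mem_top g))⟩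
  by_cases hcen : ⁅H, (⊤ : Subgroup G)⁆ ≤ K
  · refine ⟨2, Nat.prime_two, ?_⟩
    have : chiefCentralizer H K hc.1 = ⊤ := by
      refine eq_top_iff.2 fun g _ => mem_chiefCentralizer.2 fun h hh => ?_
      exact hcen (commutator_mem_commutator hh (mem_top g))
    rw [this, index_top]
    exact one_dvd _
  have hsup : ⁅H, (⊤ : Subgroup G)⁆ ⊔ K = H :=
    hc.2.2.2 _ inferInstance (right_lt_sup.2 hcen)
      (sup_le (commutator_le_left H ⊤) hc.2.2.1.le)
  have hHder : ∀ h ∈ H, (h : G ⧸ M.normalCore) ∈ commutator (G ⧸ M.normalCore) := by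
    have : H ≤ (commutator (G ⧸ M.normalCore)).comap (QuotientGroup.mk' M.normalCore) := by
      rw [← hsup, sup_le_iff]
      constructor
      · rw [commutator_le]
        intro a _ b _
        rw [mem_comap, map_commutatorElement]
        exact commutator_mem_commutator (mem_top _) (mem_top _)
      · intro k hk
        rw [mem_comap, QuotientGroup.mk'_apply, (QuotientGroup.eq_one_iff k).2 (hKN hk)]
        exact one_mem _
    exact this
  have hle : (commutator (G ⧸ M.normalCore)).comap (QuotientGroup.mk' M.normalCore) ≤
      chiefCentralizer H K hc.1 := by
    intro g hg
    refine mem_chiefCentralizer.2 fun h hh => hmem g h hh ?_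
    rw [← QuotientGroup.eq_one_iff, ← QuotientGroup.mk'_apply, map_commutatorElement,
      commutatorElement_eq_one_iff_mul_comm]
    exact hQ.commute (hHder h hh) hg
  have hdvd := index_dvd_of_le hle
  rw [index_comap_of_surjective _ (QuotientGroup.mk'_surjective _)] at hdvd
  rcases hQ with h | ⟨t, s, ht, hs, h, hcard, -⟩
  · refine absurd (fun h' hh => ?_) hHM
    have := hHder h' hh
    rw [h, mem_bot, QuotientGroup.eq_one_iff] at this
    exact M.normalCore_le this
  · refine ⟨s, hs, ?_⟩
    have h2 := (commutator (G ⧸ M.normalCore)).card_mul_index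
    rw [h, hcard] at h2
    rwa [Nat.eq_of_mul_eq_mul_left ht.pos h2] at hdvd

end ChiefFactor

section Auxiliary

theorem mem_of_prime_power_parts [Finite G] {H : Subgroup G} [H.Normal] {x : G}
    (h : ∀ r : ℕ, r.Prime → ∀ m : ℕ, (∃ k, (x ^ m) ^ r ^ k = 1) → x ^ m ∈ H) : x ∈ H := by
  by_contra hx
  have hk : orderOf (x : G ⧸ H) ≠ 1 := by
    rwa [Ne, orderOf_eq_one_iff, QuotientGroup.eq_one_iff]
  have hr := Nat.minFac_prime hk
  obtain ⟨a, m, hm, ha⟩ := Nat.exists_eq_pow_mul_and_not_dvd (orderOf_pos x).ne'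
    (orderOf (x : G ⧸ H)).minFac hr.ne_one
  have h1 := h _ hr m ⟨a, by rw [← pow_mul, mul_comm, ← ha, pow_orderOf_eq_one]⟩
  refine hm ((Nat.minFac_dvd _).trans (orderOf_dvd_of_pow_eq_one ?_))
  rwa [← QuotientGroup.mk_pow, QuotientGroup.eq_one_iff]

theorem isPGroup_zpowers {r k : ℕ} {x : G} (h : x ^ r ^ k = 1) : IsPGroup r (zpowers x) := by
  rintro ⟨y, n, rfl⟩
  refine ⟨k, Subtype.ext ?_⟩
  change (x ^ n) ^ r ^ k = 1
  rw [← zpow_natCast, zpow_comm, zpow_natCast, h, one_zpow]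

/-- A `p`-subgroup that becomes normal after adjoining the Frattini subgroup and `D` lies in a
`p`-subgroup that becomes normal after adjoining `D` alone. -/
theorem exists_isPGroup_sup_normal [Finite G] {R D : Subgroup G} {r : ℕ} [Fact r.Prime]
    (hR : IsPGroup r R) [D.Normal] (hW : (R ⊔ frattini G ⊔ D).Normal) :
    ∃ S : Subgroup G, IsPGroup r S ∧ R ≤ S ∧ S ≤ R ⊔ frattini G ⊔ D ∧ (S ⊔ D).Normal := by
  set W := R ⊔ frattini G ⊔ D with hWdef
  have hRW : R ≤ W := le_sup_left.trans le_sup_left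
  obtain ⟨Q, hQ⟩ := (hR.comap_of_injective W.subtype W.subtype_injective).exists_le_sylow
  set S := (Q : Subgroup W).map W.subtype with hS
  have hRS : R ≤ S := fun x hx => ⟨⟨x, hRW hx⟩, hQ hx, rfl⟩
  have hSW : S ≤ W := map_subtype_le _
  have htop : normalizer (S : Set G) ⊔ W = ⊤ := Q.normalizer_sup_eq_top
  have htop' : normalizer (S : Set G) ⊔ D = ⊤ := by
    refine frattini_nongenerating (eq_top_iff.2 (htop.ge.trans ?_))
    refine sup_le (le_sup_left.trans le_sup_left) (sup_le (sup_le ?_ le_sup_right) ?_)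
    · exact (hRS.trans le_normalizer).trans (le_sup_left.trans le_sup_left)
    · exact le_sup_right.trans le_sup_left
  refine ⟨S, Q.2.map _, hRS, hSW, ?_⟩
  rw [← normalizer_eq_top_iff, eq_top_iff, ← htop']
  refine sup_le ?_ (le_sup_right.trans le_normalizer)
  refine le_trans (le_inf le_rfl ?_) (normalizer_inf_normalizer_le_normalizer_sup S D)
  rw [normalizer_eq_top_iff.2 ‹D.Normal›]
  exact le_top

theorem not_dvd_card_sup [Finite G] {p : ℕ} (hp : p.Prime) {K D : Subgroup G} [D.Normal]
    (hK : ¬ p ∣ Nat.card K) (hD : ¬ p ∣ Nat.card D) : ¬ p ∣ Nat.card (K ⊔ D : Subgroup G) := by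
  intro h
  have h2 : Nat.card (K ⊔ D : Subgroup G) ∣ Nat.card D * Nat.card K := by
    rw [← relIndex_bot_left, ← relIndex_mul_relIndex ⊥ D _ bot_le le_sup_right, relIndex_bot_left,
      relIndex_sup_right]
    exact mul_dvd_mul_left _ (relIndex_dvd_card _ _)
  exact (hp.dvd_mul.1 (h.trans h2)).elim hD hK

theorem exists_max_normal_not_dvd_card [Finite G] {p : ℕ} (hp : p.Prime) :
    ∃ D : Subgroup G, D.Normal ∧ ¬ p ∣ Nat.card D ∧
      ∀ K : Subgroup G, K.Normal → ¬ p ∣ Nat.card K → K ≤ D := by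
  obtain ⟨D, hD⟩ := (Set.toFinite {D : Subgroup G | D.Normal ∧ ¬ p ∣ Nat.card D}).exists_maximal
    ⟨⊥, normal_bot, by simpa using hp.one_lt.ne'⟩
  refine ⟨D, hD.1.1, hD.1.2, fun K hK hpK => ?_⟩
  have := hD.1.1
  have h1 : K ⊔ D ≤ D := by
    exact hD.2 ⟨inferInstance, not_dvd_card_sup hp hpK hD.1.2⟩ le_sup_right
  exact le_sup_left.trans h1

theorem le_centralizer_of_not_dvd_card {p : ℕ} [Fact p.Prime] {K N : Subgroup G} [Finite G]
    (hK : K.Normal) (hN : N.Normal) (hpK : ¬ p ∣ Nat.card K) (hpN : IsPGroup p N) :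
    K ≤ centralizer (N : Set G) := by
  obtain ⟨n, hn⟩ := IsPGroup.iff_card.1 hpN
  have h : Disjoint K N := disjoint_of_coprime_natCard (by
    rw [hn]
    exact (((Nat.Prime.coprime_iff_not_dvd Fact.out).2 hpK).symm).pow_right n)
  intro k hk
  rw [mem_centralizer_iff]
  intro m hm
  exact (commute_of_normal_of_disjoint _ _ hN hK h.symm m k hm hk)

theorem exists_mem_ne_one_mem_centralizer [Finite G] {p : ℕ} [Fact p.Prime] {P N : Subgroup G}
    [hN : N.Normal] (hP : IsPGroup p P) (hpN : IsPGroup p N) (hN1 : N ≠ ⊥) :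
    ∃ n ∈ N, n ≠ 1 ∧ n ∈ centralizer (P : Set G) := by
  let : MulAction P N := MulAction.compHom N ((MulAut.conjNormal (H := N)).comp P.subtype)
  have hsmul : ∀ (a : P) (n : N), ((a • n : N) : G) = a * n * (a : G)⁻¹ := fun a n => by
    change ((MulAut.conjNormal (a : G) n : N) : G) = _
    rw [MulAut.conjNormal_apply]
  have : Nontrivial N := (nontrivial_iff_ne_bot N).2 hN1
  obtain ⟨k, hk, hc⟩ := hpN.nontrivial_iff_card.1 this
  have hd : p ∣ Nat.card N := hc ▸ dvd_pow_self p hk.ne'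
  obtain ⟨b, hb, hb1⟩ := hP.exists_fixed_point_of_prime_dvd_card_of_fixed_point N hd (a := 1)
    (fun a => Subtype.ext (by simp [hsmul]))
  refine ⟨b, b.2, fun h => hb1 (Subtype.ext h.symm), ?_⟩
  rw [mem_centralizer_iff]
  intro a ha
  have h := congrArg Subtype.val (hb ⟨a, ha⟩)
  rw [hsmul] at h
  exact mul_inv_eq_iff_eq_mul.1 h

theorem le_centralizer_of_isPGroup [Finite G] {p : ℕ} [Fact p.Prime] {P N : Subgroup G}
    [hN : N.Normal] (hP : IsPGroup p P) (hpN : IsPGroup p N) (hN1 : N ≠ ⊥)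
    (hmin : ∀ K : Subgroup G, K.Normal → K ≤ N → K = ⊥ ∨ K = N)
    (hnorm : (centralizer (P : Set G) ⊓ N).Normal) : P ≤ centralizer (N : Set G) := by
  obtain ⟨n, hn, hn1, hnP⟩ := exists_mem_ne_one_mem_centralizer hP hpN hN1
  rcases hmin _ hnorm inf_le_right with h | h
  · exact absurd ((mem_bot).1 (h ▸ (⟨hnP, hn⟩ : n ∈ centralizer (P : Set G) ⊓ N))) hn1
  · exact le_centralizer_iff.1 (inf_eq_right.1 h)

theorem mem_frattini_of_forall_isCoatom {x : G} (h : ∀ M : Subgroup G, IsCoatom M → x ∈ M) :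
    x ∈ frattini G := by
  have : zpowers x ≤ frattini G := by
    refine le_iInf₂ fun M hM => ?_
    rw [zpowers_le]
    exact h M hM
  exact zpowers_le.1 this

end Auxiliary

section Structure

theorem map_mem_commutator {Q : Type*} [Group Q] (f : G →* Q) {x : G} (hx : x ∈ commutator G) :
    f x ∈ commutator Q := by
  have h := mem_map_of_mem f hx
  rw [commutator_def, map_commutator] at h
  exact commutator_mono le_top le_top h

theorem le_normalizer_sup_of_commutatorElement_mem {K S A : Subgroup G} [A.Normal]
    (h : ∀ k ∈ K, ∀ s ∈ S, ⁅k, s⁆ ∈ A) : K ≤ normalizer ((S ⊔ A : Subgroup G) : Set G) := by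
  have h1 : ∀ k ∈ K, ∀ w ∈ S ⊔ A, k * w * k⁻¹ ∈ S ⊔ A := by
    intro k hk w hw
    obtain ⟨s, hs, a, ha, rfl⟩ := mem_sup_of_normal_right.1 hw
    have h2 : k * (s * a) * k⁻¹ = ⁅k, s⁆ * (s * (k * a * k⁻¹)) := by
      rw [commutatorElement_def]
      group
    rw [h2]
    exact mul_mem (mem_sup_right (h k hk s hs)) (mul_mem (mem_sup_left hs)
      (mem_sup_right (Normal.conj_mem inferInstance a ha k)))
  intro k hk
  rw [mem_normalizer_iff]
  refine fun w => ⟨h1 k hk w, fun hw => ?_⟩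
  have h2 := h1 k⁻¹ (inv_mem hk) _ hw
  convert h2 using 1
  group

theorem commutatorElement_mem_frattini
    (h : ∀ M : Subgroup G, IsCoatom M → HasPrimeDerived (G ⧸ M.normalCore)) {a b : G}
    (ha : a ∈ commutator G) (hb : b ∈ commutator G) : ⁅a, b⁆ ∈ frattini G := by
  refine mem_frattini_of_forall_isCoatom fun M hM => M.normalCore_le ?_
  rw [← QuotientGroup.eq_one_iff]
  have h1 := (h M hM).commute (map_mem_commutator (QuotientGroup.mk' M.normalCore) ha)
    (map_mem_commutator (QuotientGroup.mk' M.normalCore) hb)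
  exact commutatorElement_eq_one_iff_mul_comm.2 h1

theorem exists_normal_isPGroup_mem [Finite G]
    (h : ∀ M : Subgroup G, IsCoatom M → HasPrimeDerived (G ⧸ M.normalCore)) {r : ℕ}
    [Fact r.Prime] {x : G} (hx : x ∈ commutator G) {k : ℕ} (hk : x ^ r ^ k = 1) :
    ∃ S : Subgroup G, S.Normal ∧ IsPGroup r S ∧ x ∈ S := by
  obtain ⟨Q, hQ⟩ := (isPGroup_zpowers (r := r) (x := (⟨x, hx⟩ : commutator G)) (k := k)
    (Subtype.ext hk)).exists_le_sylow
  set R := (Q : Subgroup (commutator G)).map (commutator G).subtype with hR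
  have hxR : x ∈ R := ⟨⟨x, hx⟩, hQ (mem_zpowers _), rfl⟩
  have hRG : R ≤ commutator G := map_subtype_le _
  have htop : normalizer (R : Set G) ⊔ commutator G = ⊤ := Q.normalizer_sup_eq_top
  have hW : (R ⊔ frattini G).Normal := by
    rw [← normalizer_eq_top_iff, eq_top_iff, ← htop]
    refine sup_le (le_trans (le_inf le_rfl ?_) (normalizer_inf_normalizer_le_normalizer_sup _ _))
      (le_normalizer_sup_of_commutatorElement_mem fun k hk s hs =>
        commutatorElement_mem_frattini h hk (hRG hs))
    rw [normalizer_eq_top_iff.2 (inferInstance : (frattini G).Normal)]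
    exact le_top
  obtain ⟨S, hS, hRS, -, hn⟩ := exists_isPGroup_sup_normal (D := ⊥) (Q.2.map _)
    (by rwa [sup_bot_eq])
  rw [sup_bot_eq] at hn
  exact ⟨S, hn, hS, hRS hxR⟩

theorem commutator_le_centralizer [Finite G]
    (h : ∀ M : Subgroup G, IsCoatom M → HasPrimeDerived (G ⧸ M.normalCore)) {p : ℕ}
    [Fact p.Prime] {N : Subgroup G} [N.Normal] (hpN : IsPGroup p N) (hN1 : N ≠ ⊥)
    (hmin : ∀ K : Subgroup G, K.Normal → K ≤ N → K = ⊥ ∨ K = N) :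
    commutator G ≤ centralizer (N : Set G) := by
  refine fun x hx => mem_of_prime_power_parts fun r hr m ⟨k, hk⟩ => ?_
  have : Fact r.Prime := ⟨hr⟩
  obtain ⟨S, hS, hrS, hxS⟩ := exists_normal_isPGroup_mem h (pow_mem hx m) hk
  by_cases hrp : r = p
  · subst hrp
    exact le_centralizer_of_isPGroup hrS hpN hN1 hmin inferInstance hxS
  · refine le_centralizer_of_not_dvd_card hS inferInstance ?_ hpN hxS
    obtain ⟨n, hn⟩ := IsPGroup.iff_card.1 hrS
    rw [hn]
    exact fun hd => hrp ((Nat.prime_dvd_prime_iff_eq Fact.out hr).1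
      (Nat.Prime.dvd_of_dvd_pow Fact.out hd)).symm

theorem pow_sub_one_mem_centralizer [Finite G]
    (h : ∀ M : Subgroup G, IsCoatom M → HasPrimeDerived (G ⧸ M.normalCore)) {p : ℕ}
    [Fact p.Prime] {N : Subgroup G} [N.Normal] (hpN : IsPGroup p N) (hN1 : N ≠ ⊥)
    (hmin : ∀ K : Subgroup G, K.Normal → K ≤ N → K = ⊥ ∨ K = N) (x : G) :
    x ^ (p - 1) ∈ centralizer (N : Set G) := by
  have hp : p.Prime := Fact.out
  have hG := commutator_le_centralizer h hpN hN1 hmin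
  refine mem_of_prime_power_parts fun r hr m ⟨k, hk⟩ => ?_
  have : Fact r.Prime := ⟨hr⟩
  rw [pow_right_comm x (p - 1) m] at hk ⊢
  set w := x ^ m with hw
  have hz := isPGroup_zpowers hk
  by_cases hrp : r = p
  · subst hrp
    refine le_centralizer_of_isPGroup hz hpN hN1 hmin ?_ (mem_zpowers _)
    refine ⟨fun n hn g => mem_inf.2 ⟨mem_centralizer_iff.2 fun s hs => ?_,
      Normal.conj_mem inferInstance n (mem_inf.1 hn).2 g⟩⟩
    have h1 := mem_centralizer_iff.1 (mem_inf.1 hn).1 s hs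
    have h2 := mem_centralizer_iff.1 (hG (commutator_mem_commutator trivial trivial :
      ⁅s⁻¹, g⁻¹⁆ ∈ commutator G)) n (mem_inf.1 hn).2
    calc s * (g * n * g⁻¹) = g * s * (⁅s⁻¹, g⁻¹⁆ * n) * g⁻¹ := by
          rw [commutatorElement_def]
          group
      _ = g * (s * n) * ⁅s⁻¹, g⁻¹⁆ * g⁻¹ := by
          rw [← h2]
          group
      _ = g * n * g⁻¹ * s := by
          rw [h1, commutatorElement_def]
          group
  · obtain ⟨D, hD, hpD, hmax⟩ := exists_max_normal_not_dvd_card (G := G) hp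
    have hrS : ∀ S : Subgroup G, ∀ q : ℕ, q.Prime → q ≠ p → IsPGroup q S → ¬ p ∣ Nat.card S := by
      intro S q hq hqp hS hd
      have : Fact q.Prime := ⟨hq⟩
      obtain ⟨n, hn⟩ := IsPGroup.iff_card.1 hS
      rw [hn] at hd
      exact hqp ((Nat.prime_dvd_prime_iff_eq hp hq).1 (hp.dvd_of_dvd_pow hd)).symm
    have hW : (zpowers (w ^ (p - 1)) ⊔ (frattini G ⊔ D)).Normal := by
      rw [← normalizer_eq_top_iff, eq_top_iff]
      refine le_normalizer_sup_of_commutatorElement_mem fun g _ s hs => ?_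
      have hc : ⁅g, s⁆ ∈ commutator G := commutator_mem_commutator trivial trivial
      refine mem_of_prime_power_parts fun q hq n ⟨l, hl⟩ => ?_
      have : Fact q.Prime := ⟨hq⟩
      by_cases hqp : q = p
      · subst hqp
        refine mem_sup_left (mem_frattini_of_forall_isCoatom fun M hM => M.normalCore_le ?_)
        rw [← QuotientGroup.eq_one_iff]
        have hu := map_mem_commutator (QuotientGroup.mk' M.normalCore) (pow_mem hc n)
        have hpow : ∀ {t j : ℕ} {y : G}, Nat.card (commutator (G ⧸ M.normalCore)) = t → t.Prime →
            j.Prime → t ≠ j → ∀ i, y ^ j ^ i = 1 →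
            (y : G ⧸ M.normalCore) ∈ commutator (G ⧸ M.normalCore) →
            (y : G ⧸ M.normalCore) = 1 := by
          intro t j y hcard ht hj htj i hy hmem
          have h1 := pow_card_eq_one' (x := (⟨_, hmem⟩ : commutator (G ⧸ M.normalCore)))
          rw [hcard] at h1
          refine eq_one_of_pow_eq_one_of_coprime (congrArg Subtype.val h1) (n := j ^ i)
            (by rw [← QuotientGroup.mk_pow, hy, QuotientGroup.mk_one])
            (((Nat.coprime_primes ht hj).2 htj).pow_right i)
        rcases h M hM with h0 | ⟨t, s', ht, -, hcard, -, ht1⟩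
        · rwa [h0, mem_bot] at hu
        · by_cases htq : t = q
          · subst htq
            obtain ⟨j, rfl⟩ := hs
            have h1 : ((w ^ (t - 1)) ^ j : G) = (w ^ j) ^ (t - 1) := by
              rw [← zpow_natCast, zpow_comm, zpow_natCast]
            have h2 : (((w ^ (t - 1)) ^ j : G) : G ⧸ M.normalCore) = 1 := by
              refine hpow hcard ht hr (Ne.symm hrp) k ?_ ?_
              · rw [← zpow_natCast, zpow_comm, zpow_natCast, hk, one_zpow]
              · rw [h1, QuotientGroup.mk_pow]
                exact ht1 _
            have h3 : QuotientGroup.mk' M.normalCore ⁅g, (w ^ (t - 1)) ^ j⁆ = 1 := by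
              rw [map_commutatorElement, QuotientGroup.mk'_apply, QuotientGroup.mk'_apply, h2,
                commutatorElement_one_right]
            exact (QuotientGroup.mk_pow _ _ _).trans (by
              rw [← QuotientGroup.mk'_apply, h3, one_pow])
          · exact hpow hcard ht hq htq l hl hu
      · obtain ⟨S, hS, hqS, hxS⟩ := exists_normal_isPGroup_mem h (pow_mem hc n) hl
        exact mem_sup_right (hmax S hS (hrS S q hq hqp hqS) hxS)
    rw [← sup_assoc] at hW
    obtain ⟨S, hS, hRS, -, hn⟩ := exists_isPGroup_sup_normal hz hW
    exact le_centralizer_of_not_dvd_card hn inferInstance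
      (not_dvd_card_sup hp (hrS S r hr hrp hS) hpD) hpN (mem_sup_left (hRS (mem_zpowers _)))

end Structure

section MinimalNormal

theorem exists_apply_eq_pow {A : Type*} [CommGroup A] [Finite A] [Nontrivial A] {p : ℕ}
    [Fact p.Prime] (hA : ∀ a : A, a ^ p = 1) (φ : MulAut A) (hφ : φ ^ (p - 1) = 1) :
    ∃ n : A, n ≠ 1 ∧ ∃ k : ℕ, φ n = n ^ k := by
  let : Module (ZMod p) (Additive A) := AddCommGroup.zmodModule (n := p) fun a => hA a.toMul
  let f : Module.End (ZMod p) (Additive A) :=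
    AddMonoidHom.toZModLinearMap p (MonoidHom.toAdditive φ.toMonoidHom)
  have hfφ : ∀ j : ℕ, ∀ a : A, (f ^ j) (Additive.ofMul a) = Additive.ofMul ((φ ^ j) a) := by
    intro j
    induction j with
    | zero => exact fun a => rfl
    | succ j ih =>
      intro a
      rw [pow_succ, pow_succ, Module.End.mul_apply, MulAut.mul_apply, ← ih]
      rfl
  have hf : f ^ (p - 1) = 1 := by
    refine LinearMap.ext fun a => ?_
    obtain ⟨a, rfl⟩ := Additive.ofMul.surjective a
    rw [hfφ, hφ]
    rfl
  have hfp : f ^ p = f := by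
    rw [← pow_sub_one_mul (Fact.out : p.Prime).ne_zero, hf, one_mul]
  have hdvd : minpoly (ZMod p) f ∣ Polynomial.X ^ p - Polynomial.X :=
    minpoly.dvd _ _ (by simp [hfp])
  have hsplit : ((Polynomial.X ^ p - Polynomial.X : Polynomial (ZMod p))).Splits := by
    have := FiniteField.splits_X_pow_card_sub_X (K := ZMod p) p
    simpa using this
  obtain ⟨c, hc⟩ := (hsplit.of_dvd (FiniteField.X_pow_card_sub_X_ne_zero _
    (Fact.out : p.Prime).one_lt) hdvd).exists_eval_eq_zero
    (minpoly.degree_pos (Algebra.IsIntegral.isIntegral f)).ne'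
  obtain ⟨v, hv⟩ := (Module.End.hasEigenvalue_of_isRoot hc).exists_hasEigenvector
  refine ⟨v.toMul, hv.2, c.val, ?_⟩
  have h1 := hv.apply_eq_smul
  have h2 : c • v = c.val • v := by
    conv_lhs => rw [← ZMod.natCast_zmod_val c]
    rw [Nat.cast_smul_eq_nsmul]
  rw [h2] at h1
  exact h1

theorem isCyclic_of_forall_conj_eq_pow {N : Subgroup G} (hN1 : N ≠ ⊥)
    (hmin : ∀ K : Subgroup G, K.Normal → K ≤ N → K = ⊥ ∨ K = N)
    (h : ∀ g : G, ∃ k : ℕ, ∀ y ∈ N, g * y * g⁻¹ = y ^ k) : IsCyclic N := by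
  obtain ⟨y, hy, hy1⟩ := N.bot_or_exists_ne_one.resolve_left hN1
  have hnorm : (zpowers y).Normal := by
    refine ⟨?_⟩
    rintro _ ⟨j, rfl⟩ g
    obtain ⟨k, hk⟩ := h g
    change g * y ^ j * g⁻¹ ∈ _
    rw [← conj_zpow, hk y hy]
    exact zpow_mem (pow_mem (mem_zpowers y) k) j
  rcases hmin _ hnorm (zpowers_le.2 hy) with h1 | h1
  · exact absurd (zpowers_eq_bot.1 h1) hy1
  · rw [← h1]
    infer_instance

theorem isCyclic_of_minimal_normal [Finite G]
    (h : ∀ M : Subgroup G, IsCoatom M → HasPrimeDerived (G ⧸ M.normalCore)) {N : Subgroup G}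
    [hN : N.Normal] (hN1 : N ≠ ⊥)
    (hmin : ∀ K : Subgroup G, K.Normal → K ≤ N → K = ⊥ ∨ K = N) : IsCyclic N := by
  refine isCyclic_of_forall_conj_eq_pow hN1 hmin fun g => ?_
  rcases hmin (N ⊓ commutator G) inferInstance inf_le_left with hNG | hNG
  · refine ⟨1, fun y hy => ?_⟩
    have h1 : ⁅g, y⁆ ∈ N ⊓ commutator G := by
      refine mem_inf.2 ⟨?_, commutator_mem_commutator trivial trivial⟩
      rw [commutatorElement_def]
      exact mul_mem (hN.conj_mem y hy g) (inv_mem hy)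
    rw [hNG, mem_bot, commutatorElement_def, mul_inv_eq_one] at h1
    rw [h1, pow_one]
  · have hNG : N ≤ commutator G := inf_eq_left.1 hNG
    have hcard : Nat.card N ≠ 1 := fun h => hN1 (card_eq_one.1 h)
    have : Fact (Nat.card N).minFac.Prime := ⟨Nat.minFac_prime hcard⟩
    set p := (Nat.card N).minFac with hp
    obtain ⟨y, hy⟩ := exists_prime_orderOf_dvd_card' (G := N) p (Nat.minFac_dvd _)
    have hyp : (y : G) ^ p = 1 := by
      rw [← hy, ← orderOf_coe, pow_orderOf_eq_one]
    have hy1 : (y : G) ≠ 1 := by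
      rw [Ne, ← orderOf_eq_one_iff, orderOf_coe, hy]
      exact (Fact.out : p.Prime).ne_one
    obtain ⟨S, hS, hpS, hyS⟩ := exists_normal_isPGroup_mem h (hNG y.2) (r := p) (k := 1)
      (by rwa [pow_one])
    have hpN : IsPGroup p N := by
      rcases hmin (N ⊓ S) inferInstance inf_le_left with h1 | h1
      · exact absurd ((mem_bot).1 (h1 ▸ mem_inf.2 ⟨y.2, hyS⟩)) hy1
      · exact hpS.to_le (inf_eq_left.1 h1)
    have hGN := commutator_le_centralizer h hpN hN1 hmin
    have hcomm : ∀ a ∈ N, ∀ b ∈ N, a * b = b * a := fun a ha b hb =>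
      mem_centralizer_iff.1 (hGN (hNG hb)) a ha
    have hgen : ∀ {E : Subgroup G} {n : G}, E.Normal → E ≤ N → n ∈ E → n ≠ 1 → E = N := by
      intro E n hE hEN hn hn1
      exact (hmin E hE hEN).resolve_left fun h => hn1 (mem_bot.1 (h ▸ hn))
    have hexp : ∀ n ∈ N, n ^ p = 1 := by
      let E : Subgroup G :=
        { carrier := {n | n ∈ N ∧ n ^ p = 1}
          one_mem' := ⟨one_mem N, one_pow p⟩
          mul_mem' := fun {a b} ha hb => ⟨mul_mem ha.1 hb.1, by
            rw [(show Commute a b from hcomm a ha.1 b hb.1).mul_pow, ha.2, hb.2, one_mul]⟩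
          inv_mem' := fun {a} ha => ⟨inv_mem ha.1, by rw [inv_pow, ha.2, inv_one]⟩ }
      have hE : E = N := hgen ⟨fun n hn x => ⟨hN.conj_mem n hn.1 x, by
        rw [conj_pow, hn.2, mul_one, mul_inv_cancel]⟩⟩ (fun n hn => hn.1)
        (⟨y.2, hyp⟩ : (y : G) ∈ E) hy1
      exact fun n hn => (hE.ge hn).2
    let : CommGroup N := { mul_comm := fun a b => Subtype.ext (hcomm a a.2 b b.2) }
    have : Nontrivial N := (nontrivial_iff_ne_bot N).2 hN1
    obtain ⟨n, hn1, k, hk⟩ := exists_apply_eq_pow (A := N) (p := p)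
      (fun a => Subtype.ext (hexp a a.2)) (MulAut.conjNormal g) (by
        rw [← map_pow]
        refine MulEquiv.ext fun a => Subtype.ext ?_
        rw [MulAut.conjNormal_apply, ← mem_centralizer_iff.1
          (pow_sub_one_mem_centralizer h hpN hN1 hmin g) a a.2, mul_inv_cancel_right]
        rfl)
    have hnk : g * n * g⁻¹ = (n : G) ^ k := by
      rw [← MulAut.conjNormal_apply, hk]
      rfl
    let E : Subgroup G :=
      { carrier := {m | m ∈ N ∧ g * m * g⁻¹ = m ^ k}
        one_mem' := ⟨one_mem N, by simp⟩
        mul_mem' := fun {a b} ha hb => ⟨mul_mem ha.1 hb.1, by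
          rw [(show Commute a b from hcomm a ha.1 b hb.1).mul_pow, ← ha.2, ← hb.2]
          group⟩
        inv_mem' := fun {a} ha => ⟨inv_mem ha.1, by
          rw [inv_pow, ← ha.2]
          group⟩ }
    have hE : E = N := by
      refine hgen ⟨fun m hm x => ⟨hN.conj_mem m hm.1 x, ?_⟩⟩ (fun m hm => hm.1)
        (⟨n.2, hnk⟩ : (n : G) ∈ E) fun h => hn1 (Subtype.ext h)
      have h1 := mem_centralizer_iff.1 (hGN (commutator_mem_commutator trivial trivial :
        ⁅x⁻¹, g⁆ ∈ commutator G)) _ (pow_mem hm.1 k)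
      calc g * (x * m * x⁻¹) * g⁻¹
          = x * (⁅x⁻¹, g⁆ * (g * m * g⁻¹)) * ⁅x⁻¹, g⁆⁻¹ * x⁻¹ := by
            rw [commutatorElement_def]
            group
        _ = (x * m * x⁻¹) ^ k := by
            rw [hm.2, ← h1, conj_pow]
            group
    exact ⟨k, fun m hm => (hE.ge hm).2⟩

end MinimalNormal

section Supersoluble

universe u

theorem isCyclic_map_mk_iff {A B : Subgroup G} (hA : A.Normal) :
    IsCyclic (B.map (QuotientGroup.mk' A)) ↔
      ∃ x ∈ B, ∀ y ∈ B, ∃ k : ℤ, (x ^ k)⁻¹ * y ∈ A := by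
  constructor
  · rintro ⟨⟨_, x, hx, rfl⟩, hgen⟩
    refine ⟨x, hx, fun y hy => ?_⟩
    obtain ⟨k, hk⟩ := hgen ⟨QuotientGroup.mk' A y, mem_map_of_mem _ hy⟩
    refine ⟨k, ?_⟩
    rw [← QuotientGroup.eq, QuotientGroup.mk_zpow]
    exact congrArg Subtype.val hk
  · rintro ⟨x, hx, hgen⟩
    refine ⟨⟨QuotientGroup.mk' A x, mem_map_of_mem _ hx⟩, ?_⟩
    rintro ⟨_, y, hy, rfl⟩
    obtain ⟨k, hk⟩ := hgen y hy
    refine ⟨k, Subtype.ext ?_⟩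
    rw [← QuotientGroup.eq, QuotientGroup.mk_zpow] at hk
    exact hk

theorem IsSupersoluble.of_quotient {N : Subgroup G} [hN : N.Normal] (hc : IsCyclic N)
    (h : IsSupersoluble (G ⧸ N)) : IsSupersoluble G := by
  obtain ⟨n, s, hs, h0, hlast, hstep⟩ := h
  let s' : Fin (n + 1 + 1) → Subgroup G :=
    Fin.cons ⊥ fun i => (s i).comap (QuotientGroup.mk' N)
  have hs' : ∀ i, (s' i).Normal :=
    Fin.cases normal_bot fun i => (hs i).comap (QuotientGroup.mk' N)
  refine ⟨n + 1, s', hs', rfl, ?_, Fin.cases ⟨bot_le, ?_⟩ fun i => ⟨?_, ?_⟩⟩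
  · change (s (Fin.last n)).comap _ = ⊤
    rw [hlast, comap_top]
  · rw [isCyclic_map_mk_iff]
    have hs1 : s' (Fin.succ 0) = N := by
      change (s 0).comap _ = N
      rw [h0, MonoidHom.comap_bot, QuotientGroup.ker_mk']
    obtain ⟨x, hx⟩ := hc
    refine ⟨x, hs1.ge x.2, fun y hy => ?_⟩
    obtain ⟨k, hk⟩ := hx ⟨y, hs1.le hy⟩
    refine ⟨k, ?_⟩
    change _ ∈ (⊥ : Subgroup G)
    rw [mem_bot, inv_mul_eq_one]
    exact congrArg Subtype.val hk
  · exact comap_mono (hstep i).1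
  · obtain ⟨x, hx, hgen⟩ := (isCyclic_map_mk_iff (hs i.castSucc)).1 (hstep i).2
    obtain ⟨x, rfl⟩ := QuotientGroup.mk_surjective x
    rw [isCyclic_map_mk_iff]
    exact ⟨x, hx, fun y hy => hgen y hy⟩

theorem exists_minimal_normal [Finite G] [Nontrivial G] :
    ∃ N : Subgroup G, N.Normal ∧ N ≠ ⊥ ∧
      ∀ K : Subgroup G, K.Normal → K ≤ N → K = ⊥ ∨ K = N := by
  obtain ⟨N, hN⟩ := (Set.toFinite {N : Subgroup G | N.Normal ∧ N ≠ ⊥}).exists_minimal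
    ⟨⊤, inferInstance, top_ne_bot⟩
  refine ⟨N, hN.1.1, hN.1.2, fun K hK hKN => or_iff_not_imp_left.2 fun hK1 => ?_⟩
  exact le_antisymm hKN (hN.2 ⟨hK, hK1⟩ hKN)

theorem isSupersoluble_of_isModularMaximal {G : Type u} [Group G] [Finite G]
    (h : ∀ M : Subgroup G, IsCoatom M → IsModularMaximal M) : IsSupersoluble G := by
  induction hn : Nat.card G using Nat.strong_induction_on generalizing G with
  | _ n ih =>
  subst hn
  rcases subsingleton_or_nontrivial G with hG | hG
  · exact ⟨0, fun _ => ⊥, fun _ => normal_bot, rfl, Subsingleton.elim _ _, fun i => i.elim0⟩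
  · obtain ⟨N, hN, hN1, hmin⟩ := exists_minimal_normal (G := G)
    refine IsSupersoluble.of_quotient
      (isCyclic_of_minimal_normal (fun M hM => (h M hM).hasPrimeDerived) hN1 hmin)
      (ih _ ?_ (fun M hM => ?_) rfl)
    · rw [← N.card_mul_index, ← index_eq_card]
      exact lt_mul_of_one_lt_left (Nat.pos_of_ne_zero index_ne_zero_of_finite)
        (one_lt_card_iff_ne_bot N |>.2 hN1)
    · have hf := QuotientGroup.mk'_surjective N
      exact IsModularMaximal.of_comap hf (h _ (isCoatom_comap_of_surjective hf hM))

end Supersoluble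

/-- Corollary 4.1 (Schmidt): if every 2-maximal subgroup of the finite group `G` is
modular in `G`, then `G` is nearly nilpotent. -/
theorem nearlyNilpotent_of_twoMaximal_modular
    {G : Type*} [Group G] [Finite G]
    (h : ∀ M : Subgroup G, IsNMaximal 2 M → IsModularSubgroup M) :
    IsNearlyNilpotent G := by
  have hmod := fun M (hM : IsCoatom M) => isModularMaximal_of_isCoatom h hM
  refine ⟨isSupersoluble_of_isModularMaximal hmod, fun H K hc hnf => ?_⟩
  obtain ⟨M, hM, hKM, hHM⟩ := hnf.exists_isCoatom
  exact hc.exists_prime_index_dvd hKM hHM (hmod M hM).hasPrimeDerived
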